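/- arXiv:2601.03212 — 2 statements merged into one kernel-verified Lean document; each statement's English description precedes it below -/
import Mathlib

section
/- Let L₁ and L₂ be cocyclic lattices in ℤ² of indices N₁ and N₂ respectively, and set M = gcd(N₁, N₂) and N = lcm(N₁, N₂). Then L₁ ∩ L₂ is cocyclic if and only if there exists a lattice of index M containing both L₁ and L₂; and when these equivalent conditions hold, the index of L₁ ∩ L₂ in ℤ² equals N. -/
/-- `ℤ²` as the free abelian group of rank 2. -/
abbrev Z2 := ℤ × ℤ

namespace AddSubgroup

variable {A : Type*} [AddCommGroup A]

theorem index_inf_mul_index_sup (H K : AddSubgroup A) :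
    (H ⊓ K).index * (H ⊔ K).index = H.index * K.index := by
  have h := relIndex_mul_index (inf_le_right : H ⊓ K ≤ K)
  have h' := relIndex_mul_index (le_sup_left : H ≤ H ⊔ K)
  rw [inf_relIndex_right] at h
  rw [sup_comm, relIndex_sup_right] at h'
  rw [← h, ← h', sup_comm]
  ring

theorem index_dvd_exponent_quotient {H K : AddSubgroup A} (hHK : H ≤ K) [IsAddCyclic (A ⧸ K)] :
    K.index ∣ AddMonoid.exponent (A ⧸ H) := by
  have h := IsAddCyclic.exponent_eq_card (α := A ⧸ K)
  rw [AddSubgroup.index, ← h]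
  have hs : Function.Surjective (QuotientAddGroup.map H K (AddMonoidHom.id A) hHK) := by
    intro x
    induction x using QuotientAddGroup.induction_on with
    | H z => exact ⟨z, rfl⟩
  exact AddMonoidHom.exponent_dvd hs

theorem index_inf_eq_lcm (H K : AddSubgroup A) [IsAddCyclic (A ⧸ (H ⊓ K))] :
    (H ⊓ K).index = Nat.lcm H.index K.index := by
  apply Nat.dvd_antisymm
  · rw [AddSubgroup.index, ← IsAddCyclic.exponent_eq_card]
    apply AddMonoid.exponent_dvd_of_forall_nsmul_eq_zero
    intro x
    induction x using QuotientAddGroup.induction_on with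
    | H z =>
      rw [← QuotientAddGroup.mk_nsmul, QuotientAddGroup.eq_zero_iff]
      constructor
      · obtain ⟨c, hc⟩ := Nat.dvd_lcm_left H.index K.index
        rw [hc, mul_comm, mul_nsmul']
        exact H.nsmul_mem (H.nsmul_index_mem z) c
      · obtain ⟨c, hc⟩ := Nat.dvd_lcm_right H.index K.index
        rw [hc, mul_comm, mul_nsmul']
        exact K.nsmul_mem (K.nsmul_index_mem z) c
  · exact Nat.lcm_dvd (index_dvd_of_le inf_le_left) (index_dvd_of_le inf_le_right)

theorem isAddCyclic_quotient_inf {H K : AddSubgroup A} [IsAddCyclic (A ⧸ H)]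
    [IsAddCyclic (A ⧸ K)] (hH : H.index ≠ 0) (hK : K.index ≠ 0)
    (h : (H ⊓ K).index = Nat.lcm H.index K.index) : IsAddCyclic (A ⧸ (H ⊓ K)) := by
  have : (H ⊓ K).FiniteIndex := ⟨h ▸ Nat.lcm_ne_zero hH hK⟩
  apply IsAddCyclic.of_exponent_eq_card
  apply Nat.dvd_antisymm AddGroup.exponent_dvd_nat_card
  change (H ⊓ K).index ∣ _
  rw [h]
  exact Nat.lcm_dvd (index_dvd_exponent_quotient inf_le_left)
    (index_dvd_exponent_quotient inf_le_right)

end AddSubgroup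

/-- For cocyclic lattices `L₁, L₂` of indices `N₁, N₂`, with
`M = gcd(N₁,N₂)` and `N = lcm(N₁,N₂)`: the intersection `L₁ ⊓ L₂` is cocyclic iff
there is a lattice of index `M` containing both; and in that case, the index of
`L₁ ⊓ L₂` equals `N`. -/
theorem cocyclic_intersection_criterion (L₁ L₂ : AddSubgroup Z2) (N₁ N₂ : ℕ)
    (h₁ : L₁.index = N₁) (h₂ : L₂.index = N₂) (hN₁ : N₁ ≠ 0) (hN₂ : N₂ ≠ 0)
    (hc₁ : IsAddCyclic (Z2 ⧸ L₁)) (hc₂ : IsAddCyclic (Z2 ⧸ L₂)) :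
    (IsAddCyclic (Z2 ⧸ (L₁ ⊓ L₂)) ↔
      ∃ M : AddSubgroup Z2, M.index = Nat.gcd N₁ N₂ ∧ L₁ ≤ M ∧ L₂ ≤ M) ∧
    (IsAddCyclic (Z2 ⧸ (L₁ ⊓ L₂)) → (L₁ ⊓ L₂).index = Nat.lcm N₁ N₂) := by
  subst h₁ h₂
  have hmul := AddSubgroup.index_inf_mul_index_sup L₁ L₂
  rw [← Nat.gcd_mul_lcm L₁.index] at hmul
  refine ⟨⟨fun _ ↦ ⟨L₁ ⊔ L₂, ?_, le_sup_left, le_sup_right⟩, ?_⟩,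
    fun _ ↦ AddSubgroup.index_inf_eq_lcm L₁ L₂⟩
  · rw [AddSubgroup.index_inf_eq_lcm, mul_comm] at hmul
    exact Nat.eq_of_mul_eq_mul_right
      (Nat.lcm_pos (Nat.pos_of_ne_zero hN₁) (Nat.pos_of_ne_zero hN₂)) hmul
  · rintro ⟨M, hM, hM₁, hM₂⟩
    have hsup : (L₁ ⊔ L₂).index = Nat.gcd L₁.index L₂.index :=
      Nat.dvd_antisymm
        (Nat.dvd_gcd (AddSubgroup.index_dvd_of_le le_sup_left)
          (AddSubgroup.index_dvd_of_le le_sup_right))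
        (hM ▸ AddSubgroup.index_dvd_of_le (sup_le hM₁ hM₂))
    rw [hsup, mul_comm] at hmul
    exact AddSubgroup.isAddCyclic_quotient_inf hN₁ hN₂
      (Nat.eq_of_mul_eq_mul_left (Nat.gcd_pos_of_pos_left _ (Nat.pos_of_ne_zero hN₁)) hmul)
end

section
/- Let 𝒞 be a finite collection of lattices in ℤ² and let N be a positive integer divisible by the index of every lattice in 𝒞. Then 𝒞 is a covering of ℤ² if and only if every cocyclic lattice of index N in ℤ² is contained in at least one lattice of 𝒞. -/
/-- Every pair of integers is a multiple of a pair of coprime integers. -/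
lemma exists_eq_mul_isCoprime (a b : ℤ) :
    ∃ d a' b' : ℤ, IsCoprime a' b' ∧ a = d * a' ∧ b = d * b' := by
  by_cases h : a = 0 ∧ b = 0
  · exact ⟨0, 1, 0, isCoprime_one_left, by simp [h.1], by simp [h.2]⟩
  · have hpos : 0 < Int.gcd a b := Int.gcd_pos_iff.2 (by tauto)
    obtain ⟨a', b', hab, ha, hb⟩ := Int.exists_gcd_one hpos
    exact ⟨Int.gcd a b, a', b', Int.isCoprime_iff_gcd_eq_one.2 hab, by rw [mul_comm]; exact ha,
      by rw [mul_comm]; exact hb⟩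

/-- A lattice whose index divides `t` contains `t • v` for every `v`. -/
lemma AddSubgroup.zsmul_mem_of_index_dvd {A : Type*} [AddCommGroup A] (L : AddSubgroup A) {t : ℤ}
    (h : (L.index : ℤ) ∣ t) (v : A) : t • v ∈ L := by
  obtain ⟨k, rfl⟩ := h
  rw [mul_comm, mul_smul, natCast_zsmul]
  exact L.zsmul_mem (L.nsmul_index_mem v) k

/-- A cocyclic lattice of `ℤ²` is the set of solutions of a congruence `a x + b y ≡ 0` modulo its
index, with coprime coefficients. -/
lemma exists_isCoprime_mem_iff_index_dvd (M : AddSubgroup Z2) [IsAddCyclic (Z2 ⧸ M)] :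
    ∃ a b : ℤ, IsCoprime a b ∧ ∀ x y : ℤ, (x, y) ∈ M ↔ (M.index : ℤ) ∣ a * x + b * y := by
  obtain ⟨g, hg⟩ := IsAddCyclic.exists_generator (α := Z2 ⧸ M)
  obtain ⟨a, ha⟩ := AddSubgroup.mem_zmultiples_iff.1 (hg ((1, 0) : Z2))
  obtain ⟨b, hb⟩ := AddSubgroup.mem_zmultiples_iff.1 (hg ((0, 1) : Z2))
  have hord : addOrderOf g = M.index := addOrderOf_eq_card_of_forall_mem_zmultiples hg
  have hmk (x y : ℤ) : (((x, y) : Z2) : Z2 ⧸ M) = (a * x + b * y) • g := by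
    have hxy : ((x, y) : Z2) = x • ((1, 0) : Z2) + y • ((0, 1) : Z2) := by simp
    rw [hxy, QuotientAddGroup.mk_add, QuotientAddGroup.mk_zsmul, QuotientAddGroup.mk_zsmul,
      ← ha, ← hb, add_zsmul, mul_zsmul', mul_zsmul']
  obtain ⟨⟨u, v⟩, huv⟩ := QuotientAddGroup.mk_surjective g
  have hdvd : (M.index : ℤ) ∣ a * u + b * v - 1 := by
    rw [← hord, addOrderOf_dvd_iff_zsmul_eq_zero, sub_zsmul, one_zsmul, ← hmk, huv, add_neg_cancel]
  obtain ⟨d, a', b', hab, rfl, rfl⟩ := exists_eq_mul_isCoprime a b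
  have hcop : IsCoprime (M.index : ℤ) d := by
    obtain ⟨k, hk⟩ := hdvd
    exact ⟨-k, a' * u + b' * v, by linear_combination hk⟩
  refine ⟨a', b', hab, fun x y => ?_⟩
  rw [← QuotientAddGroup.eq_zero_iff, hmk, ← addOrderOf_dvd_iff_zsmul_eq_zero, hord, mul_assoc,
    mul_assoc, ← mul_add]
  exact ⟨hcop.dvd_of_dvd_mul_left, fun h => h.mul_left d⟩

/-- The solutions of `b x - a y ≡ 0` modulo `N`, with `a` and `b` coprime, form a cocyclic lattice
of index `N`, and it contains the multiples of `(a, b)`. -/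
lemma exists_cocyclic_of_isCoprime (N : ℕ) {a b : ℤ} (hab : IsCoprime a b) :
    ∃ M : AddSubgroup Z2, M.index = N ∧ IsAddCyclic (Z2 ⧸ M) ∧ ∀ d : ℤ, (d * a, d * b) ∈ M := by
  let f : Z2 →+ ZMod N := (Int.castAddHom (ZMod N)).comp
    (b • AddMonoidHom.fst ℤ ℤ - a • AddMonoidHom.snd ℤ ℤ)
  have hf (x y : ℤ) : f (x, y) = ((b * x - a * y : ℤ) : ZMod N) := by simp [f]
  have hsurj : Function.Surjective f := by
    intro z
    obtain ⟨k, rfl⟩ := ZMod.intCast_surjective z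
    obtain ⟨p, q, hpq⟩ := hab
    refine ⟨(k * q, -(k * p)), ?_⟩
    rw [hf]
    congr 1
    linear_combination k * hpq
  let e := QuotientAddGroup.quotientKerEquivOfSurjective f hsurj
  refine ⟨f.ker, ?_, isAddCyclic_of_surjective e.symm e.symm.surjective, fun d => ?_⟩
  · rw [AddSubgroup.index, Nat.card_congr e.toEquiv, Nat.card_zmod]
  · rw [AddMonoidHom.mem_ker, hf, show b * (d * a) - a * (d * b) = 0 by ring, Int.cast_zero]

/-- Let `C` be a finite collection of lattices in `ℤ²` and `N` a positive
integer divisible by all their indices. Then `C` covers `ℤ²` iff every cocyclic lattice of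
index `N` is contained in at least one member of `C`. -/
theorem covering_iff_cocyclic_contained (C : Finset (AddSubgroup Z2))
    (hlat : ∀ L ∈ C, L.index ≠ 0) (N : ℕ) (hN : 0 < N)
    (hdvd : ∀ L ∈ C, L.index ∣ N) :
    (∀ v : Z2, ∃ L ∈ C, v ∈ L) ↔
      (∀ M : AddSubgroup Z2, M.index = N → IsAddCyclic (Z2 ⧸ M) →
        ∃ L ∈ C, M ≤ L) := by
  constructor
  · rintro hcov M rfl hM
    obtain ⟨a, b, ⟨p, q, hpq⟩, hmem⟩ := exists_isCoprime_mem_iff_index_dvd M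
    obtain ⟨L, hL, hv⟩ := hcov (b, -a)
    refine ⟨L, hL, ?_⟩
    rintro ⟨x, y⟩ hxy
    have ht : (L.index : ℤ) ∣ a * x + b * y :=
      (Int.natCast_dvd_natCast.2 (hdvd L hL)).trans ((hmem x y).1 hxy)
    have hdecomp : ((x, y) : Z2) =
        (q * x - p * y) • ((b, -a) : Z2) + (a * x + b * y) • ((p, q) : Z2) := by
      ext
      · simp only [Prod.fst_add, Prod.smul_fst, smul_eq_mul]
        linear_combination -x * hpq
      · simp only [Prod.snd_add, Prod.smul_snd, smul_eq_mul]
        linear_combination -y * hpq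
    rw [hdecomp]
    exact L.add_mem (L.zsmul_mem hv _) (L.zsmul_mem_of_index_dvd ht _)
  · rintro h ⟨x, y⟩
    obtain ⟨d, a, b, hab, rfl, rfl⟩ := exists_eq_mul_isCoprime x y
    obtain ⟨M, hidx, hcyc, hmem⟩ := exists_cocyclic_of_isCoprime N hab
    obtain ⟨L, hL, hML⟩ := h M hidx hcyc
    exact ⟨L, hL, hML (hmem d)⟩
end
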